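/- arXiv:1106.4372 — 4 statements merged into one kernel-verified Lean document; each statement's English description precedes it below -/
import Mathlib

section
/- For each μ ∈ {0,1,2,3} and every value of the parameter c ∈ ℝ, the singular representative k_{(μ)ab} satisfies the tensor equation (□ - 3)k_{(μ)ab} = 0, i.e. Σ_{c,d} h⁰^{cd} D_dD_c k_{(μ)ab} = 3 k_{(μ)ab}, at every point of U. -/
noncomputable section

/-- Points of the chart `U = ℝ × (0,π) × ℝ` with coordinates `(τ, θ, φ)`. -/
abbrev Pt : Type := Fin 3 → ℝ

/-- The coordinate domain `U = ℝ × (0,π) × ℝ`. -/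
def U : Set Pt := {x | 0 < x 1 ∧ x 1 < Real.pi}

/-- Partial derivative `∂_i f` at `x`. -/
noncomputable def pd (i : Fin 3) (f : Pt → ℝ) (x : Pt) : ℝ :=
  deriv (fun t => f (Function.update x i t)) (x i)

/-- The unit-hyperboloid (dS₃) metric `h⁰_{ab}`. -/
noncomputable def h0 (x : Pt) : Fin 3 → Fin 3 → ℝ :=
  ![![-1, 0, 0],
    ![0, Real.cosh (x 0) ^ 2, 0],
    ![0, 0, Real.cosh (x 0) ^ 2 * Real.sin (x 1) ^ 2]]

/-- The inverse metric `h⁰^{ab}`. -/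
noncomputable def h0inv (x : Pt) : Fin 3 → Fin 3 → ℝ :=
  ![![-1, 0, 0],
    ![0, 1 / Real.cosh (x 0) ^ 2, 0],
    ![0, 0, 1 / (Real.cosh (x 0) ^ 2 * Real.sin (x 1) ^ 2)]]

/-- Christoffel symbols `Γ^c_{ab}` of `h⁰`; first index is the upper index. -/
noncomputable def Chr (x : Pt) : Fin 3 → Fin 3 → Fin 3 → ℝ :=
  ![![![0, 0, 0],
      ![0, Real.sinh (x 0) * Real.cosh (x 0), 0],
      ![0, 0, Real.sinh (x 0) * Real.cosh (x 0) * Real.sin (x 1) ^ 2]],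
    ![![0, Real.tanh (x 0), 0],
      ![Real.tanh (x 0), 0, 0],
      ![0, 0, -(Real.sin (x 1) * Real.cos (x 1))]],
    ![![0, 0, Real.tanh (x 0)],
      ![0, 0, Real.cos (x 1) / Real.sin (x 1)],
      ![Real.tanh (x 0), Real.cos (x 1) / Real.sin (x 1), 0]]]

/-- Covariant Hessian `D_a D_b f = ∂_a ∂_b f - Σ_c Γ^c_{ab} ∂_c f`. -/
noncomputable def hess (f : Pt → ℝ) (x : Pt) (a b : Fin 3) : ℝ :=
  pd a (pd b f) x - ∑ c, Chr x c a b * pd c f x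

/-- Covariant derivative `D_c T_{ab}` of a 2-tensor. -/
noncomputable def covD (T : Pt → Fin 3 → Fin 3 → ℝ) (x : Pt) (c a b : Fin 3) : ℝ :=
  pd c (fun y => T y a b) x - (∑ d, Chr x d c a * T x d b) - (∑ d, Chr x d c b * T x a d)

/-- Second covariant derivative `D_d D_c T_{ab}`, treating `D_c T_{ab}` as a 3-tensor. -/
noncomputable def covD2 (T : Pt → Fin 3 → Fin 3 → ℝ) (x : Pt) (d c a b : Fin 3) : ℝ :=
  pd d (fun y => covD T y c a b) x
    - (∑ e, Chr x e d c * covD T x e a b)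
    - (∑ e, Chr x e d a * covD T x c e b)
    - (∑ e, Chr x e d b * covD T x c a e)

/-- Tensor Laplacian `□T_{ab} = Σ_{c,d} h⁰^{cd} D_d D_c T_{ab}`. -/
noncomputable def boxT (T : Pt → Fin 3 → Fin 3 → ℝ) (x : Pt) (a b : Fin 3) : ℝ :=
  ∑ c, ∑ d, h0inv x c d * covD2 T x d c a b

/-- Totally antisymmetric Levi-Civita symbol with `levi 0 1 2 = 1`. -/
def levi : Fin 3 → Fin 3 → Fin 3 → ℝ :=
  ![![![0, 0, 0], ![0, 0, 1], ![0, -1, 0]],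
    ![![0, 0, -1], ![0, 0, 0], ![1, 0, 0]],
    ![![0, 1, 0], ![-1, 0, 0], ![0, 0, 0]]]

/-- Volume tensor `ε_{abc}` with `ε_{τθφ} = cosh²τ sinθ`. -/
noncomputable def epsLow (x : Pt) (a b c : Fin 3) : ℝ :=
  levi a b c * (Real.cosh (x 0) ^ 2 * Real.sin (x 1))

/-- `ε_a{}^{cd} = Σ_{e,f} ε_{aef} h⁰^{ec} h⁰^{fd}`. -/
noncomputable def epsMixed (x : Pt) (a c d : Fin 3) : ℝ :=
  ∑ e, ∑ f, epsLow x a e f * h0inv x e c * h0inv x f d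

/-- Curl of a 2-tensor: `(curl T)_{ab} = Σ_{c,d} ε_a{}^{cd} D_c T_{db}`. -/
noncomputable def curlT (T : Pt → Fin 3 → Fin 3 → ℝ) (x : Pt) (a b : Fin 3) : ℝ :=
  ∑ c, ∑ d, epsMixed x a c d * covD T x c d b

/-- The singular representatives `k_{(μ)ab}` of the tensor potential, depending on the
parameter `c`.  Indices: `0 = τ`, `1 = θ`, `2 = φ`. -/
noncomputable def kk (c : ℝ) : Fin 4 → Pt → Fin 3 → Fin 3 → ℝ :=
  ![fun x =>
      ![![0, 0, 2 * (c - Real.cos (x 1)) / Real.cosh (x 0)],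
        ![0, 0, Real.sinh (x 0) * (Real.cos (2 * x 1) - 4 * c * Real.cos (x 1) + 3) /
          (2 * Real.sin (x 1))],
        ![2 * (c - Real.cos (x 1)) / Real.cosh (x 0),
          Real.sinh (x 0) * (Real.cos (2 * x 1) - 4 * c * Real.cos (x 1) + 3) /
            (2 * Real.sin (x 1)), 0]],
    fun x =>
      ![![0, 0, -3 * (Real.tanh (x 0) / Real.cosh (x 0)) * Real.sin (x 1) ^ 2],
        ![0, 0, Real.cosh (x 0) * (-8 * c + 9 * Real.cos (x 1) - Real.cos (3 * x 1)) /
          (4 * Real.sin (x 1))],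
        ![-3 * (Real.tanh (x 0) / Real.cosh (x 0)) * Real.sin (x 1) ^ 2,
          Real.cosh (x 0) * (-8 * c + 9 * Real.cos (x 1) - Real.cos (3 * x 1)) /
            (4 * Real.sin (x 1)), 0]],
    fun x =>
      ![![0, 3 * (Real.tanh (x 0) / Real.cosh (x 0)) * Real.sin (x 2),
          3 * (Real.tanh (x 0) / Real.cosh (x 0)) * Real.cos (x 1) * Real.sin (x 1) *
            Real.cos (x 2)],
        ![3 * (Real.tanh (x 0) / Real.cosh (x 0)) * Real.sin (x 2),
          Real.cosh (x 0) * Real.sin (x 2) *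
            (8 * c - 9 * Real.cos (x 1) + Real.cos (3 * x 1)) / (2 * Real.sin (x 1) ^ 3),
          Real.cosh (x 0) * Real.cos (x 2) *
            (Real.cos (x 1) ^ 4 - 4 * c * Real.cos (x 1) + 3) / Real.sin (x 1) ^ 2],
        ![3 * (Real.tanh (x 0) / Real.cosh (x 0)) * Real.cos (x 1) * Real.sin (x 1) *
            Real.cos (x 2),
          Real.cosh (x 0) * Real.cos (x 2) *
            (Real.cos (x 1) ^ 4 - 4 * c * Real.cos (x 1) + 3) / Real.sin (x 1) ^ 2,
          Real.cosh (x 0) * Real.sin (x 2) *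
            (-8 * c + 9 * Real.cos (x 1) - Real.cos (3 * x 1)) / (2 * Real.sin (x 1))]],
    fun x =>
      ![![0, -3 * (Real.tanh (x 0) / Real.cosh (x 0)) * Real.cos (x 2),
          3 * (Real.tanh (x 0) / Real.cosh (x 0)) * Real.cos (x 1) * Real.sin (x 1) *
            Real.sin (x 2)],
        ![-3 * (Real.tanh (x 0) / Real.cosh (x 0)) * Real.cos (x 2),
          Real.cosh (x 0) * Real.cos (x 2) *
            (-8 * c + 9 * Real.cos (x 1) - Real.cos (3 * x 1)) / (2 * Real.sin (x 1) ^ 3),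
          Real.cosh (x 0) * Real.sin (x 2) *
            (Real.cos (x 1) ^ 4 - 4 * c * Real.cos (x 1) + 3) / Real.sin (x 1) ^ 2],
        ![3 * (Real.tanh (x 0) / Real.cosh (x 0)) * Real.cos (x 1) * Real.sin (x 1) *
            Real.sin (x 2),
          Real.cosh (x 0) * Real.sin (x 2) *
            (Real.cos (x 1) ^ 4 - 4 * c * Real.cos (x 1) + 3) / Real.sin (x 1) ^ 2,
          Real.cosh (x 0) * Real.cos (x 2) *
            (8 * c - 9 * Real.cos (x 1) + Real.cos (3 * x 1)) / (2 * Real.sin (x 1))]]]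

theorem sin_pos_of_mem_U {x : Pt} (hx : x ∈ U) : 0 < Real.sin (x 1) :=
  Real.sin_pos_of_pos_of_lt_pi hx.1 hx.2

theorem isOpen_U : IsOpen U :=
  (isOpen_lt continuous_const (continuous_apply 1)).inter
    (isOpen_lt (continuous_apply 1) continuous_const)

theorem eventually_update_mem_U {x : Pt} (hx : x ∈ U) (i : Fin 3) :
    ∀ᶠ t in nhds (x i), Function.update x i t ∈ U := by
  have h : Continuous fun t : ℝ => Function.update x i t := by fun_prop
  refine h.continuousAt.eventually (isOpen_U.mem_nhds ?_)
  simpa using hx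

theorem Real.hasDerivAt_tanh_sech (t : ℝ) : HasDerivAt Real.tanh (Real.cosh t ^ 2)⁻¹ t := by
  have hC := (Real.cosh_pos t).ne'
  have h := (Real.hasDerivAt_sinh t).div (Real.hasDerivAt_cosh t) hC
  have e : Real.tanh = Real.sinh / Real.cosh := funext Real.tanh_eq_sinh_div_cosh
  rw [e]
  refine h.congr_deriv ?_
  field_simp
  linarith [Real.cosh_sq_sub_sinh_sq t]

theorem Real.hasDerivAt_cot_csc {t : ℝ} (ht : Real.sin t ≠ 0) :
    HasDerivAt (fun t => Real.cos t / Real.sin t) (-(Real.sin t ^ 2)⁻¹) t := by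
  refine ((Real.hasDerivAt_cos t).fun_div (Real.hasDerivAt_sin t) ht).congr_deriv ?_
  field_simp
  linarith [Real.sin_sq_add_cos_sq t]

/-- The derivative `∂_i Γ^e_{ia}` (no summation), with arguments in the order `i e a`. -/
def dChr (x : Pt) : Fin 3 → Fin 3 → Fin 3 → ℝ :=
  ![![![0, 0, 0], ![0, (Real.cosh (x 0) ^ 2)⁻¹, 0], ![0, 0, (Real.cosh (x 0) ^ 2)⁻¹]],
    ![![0, 0, 0], ![0, 0, 0], ![0, 0, -((Real.sin (x 1) ^ 2)⁻¹)]],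
    ![![0, 0, 0], ![0, 0, 0], ![0, 0, 0]]]

theorem hasDerivAt_Chr {x : Pt} (hx : x ∈ U) (i e a : Fin 3) :
    HasDerivAt (fun t => Chr (Function.update x i t) e i a) (dChr x i e a) (x i) := by
  have h0 := Real.hasDerivAt_tanh_sech (x 0)
  have h1 := Real.hasDerivAt_cot_csc (sin_pos_of_mem_U hx).ne'
  fin_cases i <;> fin_cases e <;> fin_cases a <;>
    simp [Chr, dChr, hasDerivAt_const] <;> assumption

/-- The covariant derivative `D_c T_{ab}` with the partial derivatives `∂_c T_{ab}` given as the
values of `T₁`. -/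
def covDOf (T : Pt → Fin 3 → Fin 3 → ℝ) (T₁ : Fin 3 → Pt → Fin 3 → Fin 3 → ℝ) (x : Pt)
    (c a b : Fin 3) : ℝ :=
  T₁ c x a b - (∑ d, Chr x d c a * T x d b) - (∑ d, Chr x d c b * T x a d)

theorem covD_eq_covDOf {T : Pt → Fin 3 → Fin 3 → ℝ} {T₁ : Fin 3 → Pt → Fin 3 → Fin 3 → ℝ}
    {x : Pt} {c a b : Fin 3}
    (h : HasDerivAt (fun t => T (Function.update x c t) a b) (T₁ c x a b) (x c)) :
    covD T x c a b = covDOf T T₁ x c a b := by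
  rw [covD, pd, h.deriv, covDOf]

/-- The tensor Laplacian with the first and the diagonal second partial derivatives of `T` given
as the values of `T₁` and `T₂`. -/
def boxTOf (T : Pt → Fin 3 → Fin 3 → ℝ) (T₁ T₂ : Fin 3 → Pt → Fin 3 → Fin 3 → ℝ) (x : Pt)
    (a b : Fin 3) : ℝ :=
  ∑ c, h0inv x c c *
    (T₂ c x a b
      - (∑ d, (dChr x c d a * T x d b + Chr x d c a * T₁ c x d b))
      - (∑ d, (dChr x c d b * T x a d + Chr x d c b * T₁ c x a d))
      - (∑ e, Chr x e c c * covDOf T T₁ x e a b)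
      - (∑ e, Chr x e c a * covDOf T T₁ x c e b)
      - (∑ e, Chr x e c b * covDOf T T₁ x c a e))

theorem boxT_eq_boxTOf {T : Pt → Fin 3 → Fin 3 → ℝ} {T₁ T₂ : Fin 3 → Pt → Fin 3 → Fin 3 → ℝ}
    (h₁ : ∀ x ∈ U, ∀ i a b,
      HasDerivAt (fun t => T (Function.update x i t) a b) (T₁ i x a b) (x i))
    (h₂ : ∀ x ∈ U, ∀ i a b,
      HasDerivAt (fun t => T₁ i (Function.update x i t) a b) (T₂ i x a b) (x i))
    {x : Pt} (hx : x ∈ U) (a b : Fin 3) :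
    boxT T x a b = boxTOf T T₁ T₂ x a b := by
  have hcov : ∀ y ∈ U, ∀ c a b, covD T y c a b = covDOf T T₁ y c a b :=
    fun y hy c a b => covD_eq_covDOf (h₁ y hy c a b)
  have hpd : ∀ c, pd c (fun y => covD T y c a b) x = T₂ c x a b
        - (∑ d, (dChr x c d a * T x d b + Chr x d c a * T₁ c x d b))
        - (∑ d, (dChr x c d b * T x a d + Chr x d c b * T₁ c x a d)) := by
    intro c
    refine HasDerivAt.deriv (HasDerivAt.congr_of_eventuallyEq ?_
      ((eventually_update_mem_U hx c).mono fun t ht => hcov _ ht c a b))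
    refine ((h₂ x hx c a b).sub (HasDerivAt.fun_sum fun d _ => ?_)).sub
      (HasDerivAt.fun_sum fun d _ => ?_)
    · simpa using (hasDerivAt_Chr hx c d a).fun_mul (h₁ x hx c d b)
    · simpa using (hasDerivAt_Chr hx c d b).fun_mul (h₁ x hx c a d)
  have hdiag : boxT T x a b = ∑ c, h0inv x c c * covD2 T x c c a b := by
    simp [boxT, Fin.sum_univ_three, h0inv]
  simp only [hdiag, boxTOf, covD2, hpd, hcov x hx]

/-- The symmetric `3 × 3` array with the given upper triangle. -/
def symm3 (a b c d e f : ℝ) : Fin 3 → Fin 3 → ℝ := ![![a, b, c], ![b, d, e], ![c, e, f]]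

theorem hasDerivAt_symm3 {a b c d e f : ℝ → ℝ} {a' b' c' d' e' f' t : ℝ}
    (ha : HasDerivAt a a' t) (hb : HasDerivAt b b' t) (hc : HasDerivAt c c' t)
    (hd : HasDerivAt d d' t) (he : HasDerivAt e e' t) (hf : HasDerivAt f f' t) (i j : Fin 3) :
    HasDerivAt (fun s => symm3 (a s) (b s) (c s) (d s) (e s) (f s) i j)
      (symm3 a' b' c' d' e' f' i j) t := by
  fin_cases i <;> fin_cases j <;> assumption


/-- The tensor whose components are products of functions of a single coordinate. -/
def prodT (A B E : ℝ → Fin 3 → Fin 3 → ℝ) (x : Pt) (a b : Fin 3) : ℝ :=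
  A (x 0) a b * B (x 1) a b * E (x 2) a b

/-- The first partial derivatives of `prodT A B E`. -/
def prodT₁ (A A₁ B B₁ E E₁ : ℝ → Fin 3 → Fin 3 → ℝ) : Fin 3 → Pt → Fin 3 → Fin 3 → ℝ :=
  ![prodT A₁ B E, prodT A B₁ E, prodT A B E₁]

theorem boxT_prodT {A A₁ A₂ B B₁ B₂ E E₁ E₂ : ℝ → Fin 3 → Fin 3 → ℝ}
    (hA : ∀ t a b, HasDerivAt (fun s => A s a b) (A₁ t a b) t)
    (hA₁ : ∀ t a b, HasDerivAt (fun s => A₁ s a b) (A₂ t a b) t)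
    (hB : ∀ t, Real.sin t ≠ 0 → ∀ a b, HasDerivAt (fun s => B s a b) (B₁ t a b) t)
    (hB₁ : ∀ t, Real.sin t ≠ 0 → ∀ a b, HasDerivAt (fun s => B₁ s a b) (B₂ t a b) t)
    (hE : ∀ t a b, HasDerivAt (fun s => E s a b) (E₁ t a b) t)
    (hE₁ : ∀ t a b, HasDerivAt (fun s => E₁ s a b) (E₂ t a b) t)
    {x : Pt} (hx : x ∈ U) (a b : Fin 3) :
    boxT (prodT A B E) x a b = boxTOf (prodT A B E) (prodT₁ A A₁ B B₁ E E₁)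
      ![prodT A₂ B E, prodT A B₂ E, prodT A B E₂] x a b := by
  refine boxT_eq_boxTOf (fun x hx i a b => ?_) (fun x hx i a b => ?_) hx a b
  · have hs := (sin_pos_of_mem_U hx).ne'
    fin_cases i
    · simpa [prodT, prodT₁] using ((hA (x 0) a b).mul_const _).mul_const _
    · simpa [prodT, prodT₁] using ((hB (x 1) hs a b).const_mul _).mul_const _
    · simpa [prodT, prodT₁] using (hE (x 2) a b).const_mul _
  · have hs := (sin_pos_of_mem_U hx).ne'
    fin_cases i
    · simpa [prodT, prodT₁] using ((hA₁ (x 0) a b).mul_const _).mul_const _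
    · simpa [prodT, prodT₁] using ((hB₁ (x 1) hs a b).const_mul _).mul_const _
    · simpa [prodT, prodT₁] using (hE₁ (x 2) a b).const_mul _

theorem hasDerivAt_inv_cosh (t : ℝ) :
    HasDerivAt (fun t => 1 / Real.cosh t) (-(Real.sinh t / Real.cosh t ^ 2)) t := by
  have hC := (Real.cosh_pos t).ne'
  refine ((hasDerivAt_const t 1).fun_div (Real.hasDerivAt_cosh t) hC).congr_deriv ?_
  ring

theorem hasDerivAt_sinh_div_cosh_sq (t : ℝ) :
    HasDerivAt (fun t => Real.sinh t / Real.cosh t ^ 2)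
      (2 / Real.cosh t ^ 3 - 1 / Real.cosh t) t := by
  have hC := (Real.cosh_pos t).ne'
  have hS := Real.sinh_sq t
  refine ((Real.hasDerivAt_sinh t).fun_div ((Real.hasDerivAt_cosh t).fun_pow 2)
    (pow_ne_zero 2 hC)).congr_deriv ?_
  field_simp
  grind

theorem hasDerivAt_deriv_sinh_div_cosh_sq (t : ℝ) :
    HasDerivAt (fun t => 2 / Real.cosh t ^ 3 - 1 / Real.cosh t)
      (Real.sinh t / Real.cosh t ^ 2 - 6 * Real.sinh t / Real.cosh t ^ 4) t := by
  have hC := (Real.cosh_pos t).ne'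
  refine (((hasDerivAt_const t 2).fun_div ((Real.hasDerivAt_cosh t).fun_pow 3)
    (pow_ne_zero 3 hC)).sub (hasDerivAt_inv_cosh t)).congr_deriv ?_
  field_simp
  ring


/-- The derivative of `P (cos t) / sin t ^ n`. -/
theorem hasDerivAt_comp_cos_div_sin_pow {P : ℝ → ℝ} {P' Q t : ℝ} (n : ℕ) (ht : Real.sin t ≠ 0)
    (hP : HasDerivAt P P' (Real.cos t))
    (hQ : Q = -(1 - Real.cos t ^ 2) * P' - n * Real.cos t * P (Real.cos t)) :
    HasDerivAt (fun t => P (Real.cos t) / Real.sin t ^ n) (Q / Real.sin t ^ (n + 1)) t := by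
  refine ((hP.comp t (Real.hasDerivAt_cos t)).fun_div ((Real.hasDerivAt_sin t).fun_pow n)
    (pow_ne_zero n ht)).congr_deriv ?_
  rw [hQ, ← Real.sin_sq]
  rcases n with _ | n
  · simp only [Function.comp, Nat.cast_zero]
    field_simp
    ring
  · simp only [Function.comp, Nat.add_sub_cancel]
    field_simp
    ring

/-- The derivative of a polynomial of degree at most five. -/
theorem hasDerivAt_quintic (a b c d e f t : ℝ) :
    HasDerivAt (fun t => a * t ^ 5 + b * t ^ 4 + c * t ^ 3 + d * t ^ 2 + e * t + f)
      (5 * a * t ^ 4 + 4 * b * t ^ 3 + 3 * c * t ^ 2 + 2 * d * t + e) t := by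
  have h (n : ℕ) (a : ℝ) := (hasDerivAt_pow n t).const_mul a
  refine ((((((h 5 a).fun_add (h 4 b)).fun_add (h 3 c)).fun_add (h 2 d)).fun_add
    ((hasDerivAt_id t).const_mul e)).add_const f).congr_deriv ?_
  push_cast
  ring

/-- The derivative of a quintic polynomial in `cos t`, divided by `sin t ^ n`. -/
theorem hasDerivAt_cos_quintic_div_sin_pow (a b c d e f : ℝ) (n : ℕ) {F : ℝ → ℝ} {F' t : ℝ}
    (ht : Real.sin t ≠ 0)
    (hF : ∀ t, F t = (a * Real.cos t ^ 5 + b * Real.cos t ^ 4 + c * Real.cos t ^ 3 +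
      d * Real.cos t ^ 2 + e * Real.cos t + f) / Real.sin t ^ n)
    (hF' : F' = (-(1 - Real.cos t ^ 2) * (5 * a * Real.cos t ^ 4 + 4 * b * Real.cos t ^ 3 +
        3 * c * Real.cos t ^ 2 + 2 * d * Real.cos t + e) -
      n * Real.cos t * (a * Real.cos t ^ 5 + b * Real.cos t ^ 4 + c * Real.cos t ^ 3 +
        d * Real.cos t ^ 2 + e * Real.cos t + f)) / Real.sin t ^ (n + 1)) :
    HasDerivAt F F' t := by
  rw [funext hF, hF']
  exact hasDerivAt_comp_cos_div_sin_pow n ht (hasDerivAt_quintic a b c d e f (Real.cos t)) rfl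

theorem kk_zero_eq (c : ℝ) : kk c 0 = prodT
    (fun t => symm3 0 0 (1 / Real.cosh t) 0 (Real.sinh t) 0)
    (fun t => symm3 0 0 (2 * (c - Real.cos t)) 0
      ((Real.cos t ^ 2 - 2 * c * Real.cos t + 1) / Real.sin t ^ 1) 0)
    (fun _ _ _ => 1) := by
  funext x a b
  fin_cases a <;> fin_cases b <;>
    simp [kk, prodT, symm3, Real.cos_two_mul] <;> ring

theorem kk_one_eq (c : ℝ) : kk c 1 = prodT
    (fun t => symm3 0 0 (Real.sinh t / Real.cosh t ^ 2) 0 (Real.cosh t) 0)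
    (fun t => symm3 0 0 (-3 * Real.sin t ^ 2) 0
      ((-Real.cos t ^ 3 + 3 * Real.cos t - 2 * c) / Real.sin t ^ 1) 0)
    (fun _ _ _ => 1) := by
  funext x a b
  fin_cases a <;> fin_cases b <;>
    simp [kk, prodT, symm3, Real.cos_three_mul, Real.tanh_eq_sinh_div_cosh] <;>
    ring

/-- The common form of the tensors `kk c 2` and `kk c 3`, with angular factors `p` and `q`. -/
def kkAngular (c : ℝ) (p q : ℝ → ℝ) : Pt → Fin 3 → Fin 3 → ℝ := prodT
    (fun t => symm3 0 (Real.sinh t / Real.cosh t ^ 2) (Real.sinh t / Real.cosh t ^ 2)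
      (Real.cosh t) (Real.cosh t) (Real.cosh t))
    (fun t => symm3 0 3 (3 * (Real.cos t * Real.sin t))
      ((2 * Real.cos t ^ 3 - 6 * Real.cos t + 4 * c) / Real.sin t ^ 3)
      ((Real.cos t ^ 4 - 4 * c * Real.cos t + 3) / Real.sin t ^ 2)
      ((-2 * Real.cos t ^ 3 + 6 * Real.cos t - 4 * c) / Real.sin t ^ 1))
    (fun t => symm3 0 (p t) (q t) (p t) (q t) (p t))

theorem kk_two_eq (c : ℝ) : kk c 2 = kkAngular c Real.sin Real.cos := by
  funext x a b
  fin_cases a <;> fin_cases b <;>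
    simp [kk, kkAngular, prodT, symm3, Real.cos_three_mul, Real.tanh_eq_sinh_div_cosh,
      -mul_eq_mul_right_iff] <;> ring

theorem kk_three_eq (c : ℝ) : kk c 3 = kkAngular c (fun t => -Real.cos t) Real.sin := by
  funext x a b
  fin_cases a <;> fin_cases b <;>
    simp [kk, kkAngular, prodT, symm3, Real.cos_three_mul, Real.tanh_eq_sinh_div_cosh,
      -mul_eq_mul_right_iff] <;> ring

theorem boxT_kk_zero (c : ℝ) {x : Pt} (hx : x ∈ U) (a b : Fin 3) :
    boxT (kk c 0) x a b = 3 * kk c 0 x a b := by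
  rw [kk_zero_eq, boxT_prodT
    (A₁ := fun t => symm3 0 0 (-(Real.sinh t / Real.cosh t ^ 2)) 0 (Real.cosh t) 0)
    (A₂ := fun t => symm3 0 0 (-(2 / Real.cosh t ^ 3 - 1 / Real.cosh t)) 0 (Real.sinh t) 0)
    (B₁ := fun t => symm3 0 0 (2 * Real.sin t) 0
      ((Real.cos t ^ 3 - 3 * Real.cos t + 2 * c) / Real.sin t ^ 2) 0)
    (B₂ := fun t => symm3 0 0 (2 * Real.cos t) 0
      ((Real.cos t ^ 4 - 4 * c * Real.cos t + 3) / Real.sin t ^ 3) 0)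
    (E₁ := fun _ _ _ => 0) (E₂ := fun _ _ _ => 0)
    _ _ _ _ _ _ hx]
  · have hC := (Real.cosh_pos (x 0)).ne'
    have hs := (sin_pos_of_mem_U hx).ne'
    have hS := Real.cosh_sq_sub_sinh_sq (x 0)
    have hk := Real.sin_sq_add_cos_sq (x 1)
    fin_cases a <;> fin_cases b <;>
      simp [boxTOf, covDOf, prodT, prodT₁, symm3, h0inv, Chr, dChr, Fin.sum_univ_three,
        Real.tanh_eq_sinh_div_cosh] <;>
      generalize Real.cosh (x 0) = C at * <;> generalize Real.sinh (x 0) = S at * <;>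
      generalize Real.sin (x 1) = s at * <;> generalize Real.cos (x 1) = k at * <;>
      field_simp <;> grind
  · intro t a b
    exact hasDerivAt_symm3 (hasDerivAt_const _ _) (hasDerivAt_const _ _) (hasDerivAt_inv_cosh t)
      (hasDerivAt_const _ _) (Real.hasDerivAt_sinh t) (hasDerivAt_const _ _) a b
  · intro t a b
    exact hasDerivAt_symm3 (hasDerivAt_const _ _) (hasDerivAt_const _ _)
      (hasDerivAt_sinh_div_cosh_sq t).fun_neg
      (hasDerivAt_const _ _) (Real.hasDerivAt_cosh t) (hasDerivAt_const _ _) a b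
  · intro t ht a b
    refine hasDerivAt_symm3 (hasDerivAt_const _ _) (hasDerivAt_const _ _) ?_
      (hasDerivAt_const _ _) ?_ (hasDerivAt_const _ _) a b
    · simpa using ((Real.hasDerivAt_cos t).const_sub c).const_mul 2
    · refine hasDerivAt_cos_quintic_div_sin_pow 0 0 0 1 (-2 * c) 1 1 ht ?_ ?_ <;>
        intros <;> push_cast <;> ring
  · intro t ht a b
    refine hasDerivAt_symm3 (hasDerivAt_const _ _) (hasDerivAt_const _ _) ?_
      (hasDerivAt_const _ _) ?_ (hasDerivAt_const _ _) a b
    · exact (Real.hasDerivAt_sin t).const_mul 2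
    · refine hasDerivAt_cos_quintic_div_sin_pow 0 0 1 0 (-3) (2 * c) 2 ht ?_ ?_ <;>
        intros <;> push_cast <;> ring
  · exact fun t a b => hasDerivAt_const _ _
  · exact fun t a b => hasDerivAt_const _ _

theorem boxT_kk_one (c : ℝ) {x : Pt} (hx : x ∈ U) (a b : Fin 3) :
    boxT (kk c 1) x a b = 3 * kk c 1 x a b := by
  rw [kk_one_eq, boxT_prodT
    (A₁ := fun t => symm3 0 0 (2 / Real.cosh t ^ 3 - 1 / Real.cosh t) 0 (Real.sinh t) 0)
    (A₂ := fun t => symm3 0 0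
      (Real.sinh t / Real.cosh t ^ 2 - 6 * Real.sinh t / Real.cosh t ^ 4) 0 (Real.cosh t) 0)
    (B₁ := fun t => symm3 0 0 (-6 * (Real.sin t * Real.cos t)) 0
      ((-2 * Real.cos t ^ 4 + 3 * Real.cos t ^ 2 + 2 * c * Real.cos t - 3) / Real.sin t ^ 2) 0)
    (B₂ := fun t => symm3 0 0 (-6 * (Real.cos t ^ 2 - Real.sin t ^ 2)) 0
      ((-4 * Real.cos t ^ 5 + 8 * Real.cos t ^ 3 - 2 * c * Real.cos t ^ 2 - 2 * c) /
        Real.sin t ^ 3) 0)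
    (E₁ := fun _ _ _ => 0) (E₂ := fun _ _ _ => 0)
    _ _ _ _ _ _ hx]
  · have hC := (Real.cosh_pos (x 0)).ne'
    have hs := (sin_pos_of_mem_U hx).ne'
    have hS := Real.cosh_sq_sub_sinh_sq (x 0)
    have hk := Real.sin_sq_add_cos_sq (x 1)
    fin_cases a <;> fin_cases b <;>
      simp [boxTOf, covDOf, prodT, prodT₁, symm3, h0inv, Chr, dChr, Fin.sum_univ_three,
        Real.tanh_eq_sinh_div_cosh] <;>
      generalize Real.cosh (x 0) = C at * <;> generalize Real.sinh (x 0) = S at * <;>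
      generalize Real.sin (x 1) = s at * <;> generalize Real.cos (x 1) = k at * <;>
      field_simp <;> grind
  · intro t a b
    exact hasDerivAt_symm3 (hasDerivAt_const _ _) (hasDerivAt_const _ _)
      (hasDerivAt_sinh_div_cosh_sq t) (hasDerivAt_const _ _) (Real.hasDerivAt_cosh t)
      (hasDerivAt_const _ _) a b
  · intro t a b
    exact hasDerivAt_symm3 (hasDerivAt_const _ _) (hasDerivAt_const _ _)
      (hasDerivAt_deriv_sinh_div_cosh_sq t) (hasDerivAt_const _ _) (Real.hasDerivAt_sinh t)
      (hasDerivAt_const _ _) a b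
  · intro t ht a b
    refine hasDerivAt_symm3 (hasDerivAt_const _ _) (hasDerivAt_const _ _) ?_
      (hasDerivAt_const _ _) ?_ (hasDerivAt_const _ _) a b
    · exact (((Real.hasDerivAt_sin t).fun_pow 2).const_mul (-3)).congr_deriv (by push_cast; ring)
    · refine hasDerivAt_cos_quintic_div_sin_pow 0 0 (-1) 0 3 (-2 * c) 1 ht ?_ ?_ <;>
        intros <;> push_cast <;> ring
  · intro t ht a b
    refine hasDerivAt_symm3 (hasDerivAt_const _ _) (hasDerivAt_const _ _) ?_
      (hasDerivAt_const _ _) ?_ (hasDerivAt_const _ _) a b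
    · exact (((Real.hasDerivAt_sin t).fun_mul (Real.hasDerivAt_cos t)).const_mul
        (-6)).congr_deriv (by ring)
    · refine hasDerivAt_cos_quintic_div_sin_pow 0 (-2) 0 3 (2 * c) (-3) 2 ht ?_ ?_ <;>
        intros <;> push_cast <;> ring
  · exact fun t a b => hasDerivAt_const _ _
  · exact fun t a b => hasDerivAt_const _ _

theorem boxT_kkAngular (c : ℝ) {p q : ℝ → ℝ} (hp : ∀ t, HasDerivAt p (q t) t)
    (hq : ∀ t, HasDerivAt q (-p t) t) {x : Pt} (hx : x ∈ U) (a b : Fin 3) :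
    boxT (kkAngular c p q) x a b = 3 * kkAngular c p q x a b := by
  rw [kkAngular, boxT_prodT
    (A₁ := fun t => symm3 0 (2 / Real.cosh t ^ 3 - 1 / Real.cosh t)
      (2 / Real.cosh t ^ 3 - 1 / Real.cosh t) (Real.sinh t) (Real.sinh t) (Real.sinh t))
    (A₂ := fun t => symm3 0 (Real.sinh t / Real.cosh t ^ 2 - 6 * Real.sinh t / Real.cosh t ^ 4)
      (Real.sinh t / Real.cosh t ^ 2 - 6 * Real.sinh t / Real.cosh t ^ 4)
      (Real.cosh t) (Real.cosh t) (Real.cosh t))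
    (B₁ := fun t => symm3 0 0 (3 * (Real.cos t ^ 2 - Real.sin t ^ 2))
      ((6 * Real.cos t ^ 2 - 12 * c * Real.cos t + 6) / Real.sin t ^ 4)
      ((2 * Real.cos t ^ 5 - 4 * Real.cos t ^ 3 + 4 * c * Real.cos t ^ 2 - 6 * Real.cos t +
        4 * c) / Real.sin t ^ 3)
      ((-4 * Real.cos t ^ 4 + 6 * Real.cos t ^ 2 + 4 * c * Real.cos t - 6) / Real.sin t ^ 2))
    (B₂ := fun t => symm3 0 0 (-12 * (Real.cos t * Real.sin t))
      ((-12 * Real.cos t ^ 3 + 36 * c * Real.cos t ^ 2 - 36 * Real.cos t + 12 * c) /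
        Real.sin t ^ 5)
      ((4 * Real.cos t ^ 6 - 10 * Real.cos t ^ 4 - 4 * c * Real.cos t ^ 3 + 24 * Real.cos t ^ 2 -
        20 * c * Real.cos t + 6) / Real.sin t ^ 4)
      ((-8 * Real.cos t ^ 5 + 16 * Real.cos t ^ 3 - 4 * c * Real.cos t ^ 2 - 4 * c) /
        Real.sin t ^ 3))
    (E₁ := fun t => symm3 0 (q t) (-p t) (q t) (-p t) (q t))
    (E₂ := fun t => symm3 0 (-p t) (-q t) (-p t) (-q t) (-p t))
    _ _ _ _ _ _ hx]
  · have hC := (Real.cosh_pos (x 0)).ne'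
    have hs := (sin_pos_of_mem_U hx).ne'
    have hS := Real.cosh_sq_sub_sinh_sq (x 0)
    have hk := Real.sin_sq_add_cos_sq (x 1)
    fin_cases a <;> fin_cases b <;>
      simp [boxTOf, covDOf, prodT, prodT₁, symm3, h0inv, Chr, dChr, Fin.sum_univ_three,
        Real.tanh_eq_sinh_div_cosh] <;>
      generalize Real.cosh (x 0) = C at * <;> generalize Real.sinh (x 0) = S at * <;>
      generalize Real.sin (x 1) = s at * <;> generalize Real.cos (x 1) = k at * <;>
      generalize p (x 2) = P at * <;> generalize q (x 2) = Q at * <;>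
      clear hp hq hx <;> field_simp <;> grind
  · intro t a b
    exact hasDerivAt_symm3 (hasDerivAt_const _ _)
      (hasDerivAt_sinh_div_cosh_sq t) (hasDerivAt_sinh_div_cosh_sq t) (Real.hasDerivAt_cosh t)
      (Real.hasDerivAt_cosh t) (Real.hasDerivAt_cosh t) a b
  · intro t a b
    exact hasDerivAt_symm3 (hasDerivAt_const _ _)
      (hasDerivAt_deriv_sinh_div_cosh_sq t) (hasDerivAt_deriv_sinh_div_cosh_sq t)
      (Real.hasDerivAt_sinh t) (Real.hasDerivAt_sinh t) (Real.hasDerivAt_sinh t) a b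
  · intro t ht a b
    refine hasDerivAt_symm3 (hasDerivAt_const _ _) (hasDerivAt_const _ _) ?_ ?_ ?_ ?_ a b
    · exact (((Real.hasDerivAt_cos t).fun_mul (Real.hasDerivAt_sin t)).const_mul
        3).congr_deriv (by ring)
    · refine hasDerivAt_cos_quintic_div_sin_pow 0 0 2 0 (-6) (4 * c) 3 ht ?_ ?_ <;>
        intros <;> push_cast <;> ring
    · refine hasDerivAt_cos_quintic_div_sin_pow 0 1 0 0 (-4 * c) 3 2 ht ?_ ?_ <;>
        intros <;> push_cast <;> ring
    · refine hasDerivAt_cos_quintic_div_sin_pow 0 0 (-2) 0 6 (-4 * c) 1 ht ?_ ?_ <;>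
        intros <;> push_cast <;> ring
  · intro t ht a b
    refine hasDerivAt_symm3 (hasDerivAt_const _ _) (hasDerivAt_const _ _) ?_ ?_ ?_ ?_ a b
    · exact ((((Real.hasDerivAt_cos t).fun_pow 2).sub ((Real.hasDerivAt_sin t).fun_pow 2)).const_mul
        3).congr_deriv (by push_cast; ring)
    · refine hasDerivAt_cos_quintic_div_sin_pow 0 0 0 6 (-12 * c) 6 4 ht ?_ ?_ <;>
        intros <;> push_cast <;> ring
    · refine hasDerivAt_cos_quintic_div_sin_pow 2 0 (-4) (4 * c) (-6) (4 * c) 3 ht ?_ ?_ <;>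
        intros <;> push_cast <;> ring
    · refine hasDerivAt_cos_quintic_div_sin_pow 0 (-4) 0 6 (4 * c) (-6) 2 ht ?_ ?_ <;>
        intros <;> push_cast <;> ring
  · exact fun t a b => hasDerivAt_symm3 (hasDerivAt_const _ _) (hp t) (hq t) (hp t) (hq t) (hp t)
      a b
  · exact fun t a b => hasDerivAt_symm3 (hasDerivAt_const _ _) (hq t) (hp t).fun_neg (hq t)
      (hp t).fun_neg (hq t) a b

/-- Each singular representative `k_{(μ)ab}` satisfies `(□ - 3)k_{(μ)ab} = 0` on `U`,
for every value of the parameter `c`. -/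
theorem stmt12 : ∀ (μ : Fin 4) (c : ℝ), ∀ x ∈ U, ∀ a b : Fin 3,
    boxT (kk c μ) x a b = 3 * kk c μ x a b := by
  intro μ c x hx a b
  fin_cases μ
  · exact boxT_kk_zero c hx a b
  · exact boxT_kk_one c hx a b
  · change boxT (kk c 2) x a b = 3 * kk c 2 x a b
    rw [kk_two_eq]
    exact boxT_kkAngular c Real.hasDerivAt_sin Real.hasDerivAt_cos hx a b
  · change boxT (kk c 3) x a b = 3 * kk c 3 x a b
    rw [kk_three_eq]
    exact boxT_kkAngular c (fun t => by simpa using (Real.hasDerivAt_cos t).fun_neg)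
      (fun t => by simpa using Real.hasDerivAt_sin t) hx a b
end
end

section
/- For each μ ∈ {0,1,2,3} and every value of the parameter c ∈ ℝ, the curl of the singular representative k_{(μ)} is symmetric and is a nonzero constant multiple of the tensor built from ζ̂_μ: there exists a real constant λ_μ ≠ 0 (independent of the point of U and of c) such that Σ_{c,d} ε_a{}^{cd} D_c k_{(μ)db} = λ_μ (D_aD_b ζ̂_μ + h⁰_{ab} ζ̂_μ) at every point of U and for all indices a,b. -/
noncomputable section

/-- The other set of lowest harmonics `ζ̂_μ`. -/
noncomputable def zetaHat : Fin 4 → Pt → ℝ :=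
  ![fun x => Real.cosh (2 * x 0) / Real.cosh (x 0),
    fun x => (2 * Real.sinh (x 0) + Real.tanh (x 0) / Real.cosh (x 0)) * Real.cos (x 1),
    fun x => (2 * Real.sinh (x 0) + Real.tanh (x 0) / Real.cosh (x 0)) * Real.sin (x 1) * Real.cos (x 2),
    fun x => (2 * Real.sinh (x 0) + Real.tanh (x 0) / Real.cosh (x 0)) * Real.sin (x 1) * Real.sin (x 2)]

theorem curlT_zero (T : Pt → Fin 3 → Fin 3 → ℝ) {x : Pt} (hx : Real.sin (x 1) ≠ 0) (b : Fin 3) :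
    curlT T x 0 b = (covD T x 1 2 b - covD T x 2 1 b) / (Real.cosh (x 0) ^ 2 * Real.sin (x 1)) := by
  have hc : Real.cosh (x 0) ≠ 0 := (Real.cosh_pos _).ne'
  simp [curlT, epsMixed, epsLow, levi, h0inv, Fin.sum_univ_three]
  field_simp
  ring

theorem curlT_one (T : Pt → Fin 3 → Fin 3 → ℝ) {x : Pt} (hx : Real.sin (x 1) ≠ 0) (b : Fin 3) :
    curlT T x 1 b = (covD T x 0 2 b - covD T x 2 0 b) / Real.sin (x 1) := by
  have hc : Real.cosh (x 0) ≠ 0 := (Real.cosh_pos _).ne'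
  simp [curlT, epsMixed, epsLow, levi, h0inv, Fin.sum_univ_three]
  field_simp
  ring

theorem curlT_two (T : Pt → Fin 3 → Fin 3 → ℝ) (x : Pt) (b : Fin 3) :
    curlT T x 2 b = (covD T x 1 0 b - covD T x 0 1 b) * Real.sin (x 1) := by
  have hc : Real.cosh (x 0) ≠ 0 := (Real.cosh_pos _).ne'
  simp [curlT, epsMixed, epsLow, levi, h0inv, Fin.sum_univ_three]
  field_simp
  ring

/-- The function `(τ, θ, φ) ↦ f τ * g θ * h φ`. -/
def sep (f g h : ℝ → ℝ) (x : Pt) : ℝ := f (x 0) * g (x 1) * h (x 2)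

theorem pd_zero_sep (f g h : ℝ → ℝ) : pd 0 (sep f g h) = sep (deriv f) g h := by
  ext x
  simp [pd, sep]

theorem pd_one_sep (f g h : ℝ → ℝ) : pd 1 (sep f g h) = sep f (deriv g) h := by
  ext x
  simp [pd, sep]

theorem pd_two_sep (f g h : ℝ → ℝ) : pd 2 (sep f g h) = sep f g (deriv h) := by
  ext x
  simp [pd, sep]

theorem hess_sep_symm (f g h : ℝ → ℝ) (x : Pt) (a b : Fin 3) :
    hess (sep f g h) x a b = hess (sep f g h) x b a := by
  fin_cases a <;> fin_cases b <;>
    simp [hess, Chr, Fin.sum_univ_three, pd_zero_sep, pd_one_sep, pd_two_sep]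

theorem h0_symm (x : Pt) (a b : Fin 3) : h0 x a b = h0 x b a := by
  fin_cases a <;> fin_cases b <;> simp [h0]

theorem pd_const_zero (i : Fin 3) (x : Pt) : pd i (fun _ => 0) x = 0 := by
  simp [pd]

/-- The quotient `g θ / sinⁿ θ`. -/
def divSin (n : ℕ) (g : ℝ → ℝ) (t : ℝ) : ℝ := g t / Real.sin t ^ n

theorem deriv_divSin {g : ℝ → ℝ} {g' t : ℝ} (n : ℕ) (hg : HasDerivAt g g' t)
    (ht : Real.sin t ≠ 0) :
    deriv (divSin n g) t
      = g' / Real.sin t ^ n - n * g t * Real.cos t / Real.sin t ^ (n + 1) := by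
  have h := hg.fun_div ((Real.hasDerivAt_sin t).fun_pow n) (pow_ne_zero n ht)
  refine (h.deriv : deriv (divSin n g) t = _).trans ?_
  rcases n with _ | n
  · simp
  · simp only [Nat.add_sub_cancel]
    field_simp
    ring

/-- The profile `2c - 3 cos θ + cos³ θ`, a primitive of `3 sin³ θ`. -/
def cubicCos (c t : ℝ) : ℝ := 2 * c - 3 * Real.cos t + Real.cos t ^ 3

/-- The profile `cos⁴ θ - 4 c cos θ + 3`. -/
def quarticCos (c t : ℝ) : ℝ := Real.cos t ^ 4 - 4 * c * Real.cos t + 3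

/-- The profile `cos² θ - 2 c cos θ + 1`. -/
def quadraticCos (c t : ℝ) : ℝ := Real.cos t ^ 2 - 2 * c * Real.cos t + 1

theorem hasDerivAt_cubicCos (c t : ℝ) : HasDerivAt (cubicCos c) (3 * Real.sin t ^ 3) t := by
  have hc := Real.hasDerivAt_cos t
  refine (((hc.const_mul 3).const_sub (2 * c)).add (hc.fun_pow 3)).congr_deriv ?_
  linear_combination (-3 * Real.sin t) * Real.sin_sq_add_cos_sq t

theorem hasDerivAt_quarticCos (c t : ℝ) :
    HasDerivAt (quarticCos c) (4 * (c - Real.cos t ^ 3) * Real.sin t) t := by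
  have hc := Real.hasDerivAt_cos t
  refine (((hc.fun_pow 4).sub (hc.const_mul (4 * c))).add_const 3).congr_deriv ?_
  ring

theorem hasDerivAt_quadraticCos (c t : ℝ) :
    HasDerivAt (quadraticCos c) (2 * (c - Real.cos t) * Real.sin t) t := by
  have hc := Real.hasDerivAt_cos t
  refine (((hc.fun_pow 2).sub (hc.const_mul (2 * c))).add_const 1).congr_deriv ?_
  ring

theorem deriv_sin_sq : deriv (fun t => Real.sin t ^ 2) = fun t => 2 * Real.sin t * Real.cos t := by
  ext t
  simp

theorem deriv_cos_mul_sin :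
    deriv (fun t => Real.cos t * Real.sin t) = fun t => Real.cos t ^ 2 - Real.sin t ^ 2 := by
  ext t
  rw [((Real.hasDerivAt_cos t).fun_mul (Real.hasDerivAt_sin t)).deriv]
  ring

theorem deriv_sub_cos (c : ℝ) : deriv (fun t => c - Real.cos t) = Real.sin := by
  ext t
  simp

theorem deriv_inv_cosh :
    deriv (fun t => 2 / Real.cosh t) = fun t => -2 * Real.sinh t / Real.cosh t ^ 2 := by
  ext t
  have hc : Real.cosh t ≠ 0 := (Real.cosh_pos t).ne'
  rw [((hasDerivAt_const t (2 : ℝ)).fun_div (Real.hasDerivAt_cosh t) hc).deriv]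
  ring

/-- The time profile `r tanh τ sech τ`. -/
def tanhSech (r t : ℝ) : ℝ := r * (Real.sinh t / Real.cosh t ^ 2)

theorem deriv_tanhSech (r : ℝ) :
    deriv (tanhSech r) = fun t => r * (2 / Real.cosh t ^ 3 - 1 / Real.cosh t) := by
  ext t
  have hc : Real.cosh t ≠ 0 := (Real.cosh_pos t).ne'
  refine (HasDerivAt.congr_deriv (((Real.hasDerivAt_sinh t).fun_div
    ((Real.hasDerivAt_cosh t).fun_pow 2) (pow_ne_zero 2 hc)).const_mul r) ?_).deriv
  field_simp
  linear_combination (2 * r * Real.cosh t) * Real.cosh_sq_sub_sinh_sq t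

/-- The time profile `cosh 2τ / cosh τ` of `ζ̂₀`. -/
def monopoleTime (t : ℝ) : ℝ := 2 * Real.cosh t - 1 / Real.cosh t

/-- The time profile `2 sinh τ + tanh τ sech τ` of `ζ̂₁`, `ζ̂₂`, `ζ̂₃`. -/
def dipoleTime (t : ℝ) : ℝ := 2 * Real.sinh t + Real.sinh t / Real.cosh t ^ 2

/-- The derivative of `dipoleTime`. -/
def dipoleTimeDeriv (t : ℝ) : ℝ := 2 * Real.cosh t - 1 / Real.cosh t + 2 / Real.cosh t ^ 3

theorem deriv_monopoleTime : deriv monopoleTime = dipoleTime := by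
  ext t
  have hc : Real.cosh t ≠ 0 := (Real.cosh_pos t).ne'
  refine (HasDerivAt.congr_deriv (((Real.hasDerivAt_cosh t).const_mul 2).sub
    ((hasDerivAt_const t (1 : ℝ)).fun_div (Real.hasDerivAt_cosh t) hc)) ?_).deriv
  rw [dipoleTime]
  ring

theorem deriv_dipoleTime : deriv dipoleTime = dipoleTimeDeriv := by
  ext t
  have hc : Real.cosh t ≠ 0 := (Real.cosh_pos t).ne'
  refine (HasDerivAt.congr_deriv (((Real.hasDerivAt_sinh t).const_mul 2).add
    ((Real.hasDerivAt_sinh t).fun_div ((Real.hasDerivAt_cosh t).fun_pow 2)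
      (pow_ne_zero 2 hc))) ?_).deriv
  rw [dipoleTimeDeriv]
  field_simp
  linear_combination (2 * Real.cosh t) * Real.cosh_sq_sub_sinh_sq t

theorem deriv_dipoleTimeDeriv : deriv dipoleTimeDeriv =
    fun t => 2 * Real.sinh t + Real.sinh t / Real.cosh t ^ 2
      - 6 * Real.sinh t / Real.cosh t ^ 4 := by
  ext t
  have hc : Real.cosh t ≠ 0 := (Real.cosh_pos t).ne'
  have hC := Real.hasDerivAt_cosh t
  refine (HasDerivAt.congr_deriv (((hC.const_mul 2).sub
    ((hasDerivAt_const t (1 : ℝ)).fun_div hC hc)).add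
      ((hasDerivAt_const t (2 : ℝ)).fun_div (hC.fun_pow 3) (pow_ne_zero 3 hc))) ?_).deriv
  field_simp
  ring

theorem tanh_div_cosh (t : ℝ) : Real.tanh t / Real.cosh t = Real.sinh t / Real.cosh t ^ 2 := by
  rw [Real.tanh_eq_sinh_div_cosh, div_div, sq]

theorem zetaHat_zero : zetaHat 0 = sep monopoleTime 1 1 := by
  ext x
  have hc : Real.cosh (x 0) ≠ 0 := (Real.cosh_pos _).ne'
  simp only [zetaHat, sep, monopoleTime, Real.cosh_two_mul, Matrix.cons_val, Pi.one_apply]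
  field_simp
  linear_combination -Real.cosh_sq_sub_sinh_sq (x 0)

theorem zetaHat_one : zetaHat 1 = sep dipoleTime Real.cos 1 := by
  ext x
  simp [zetaHat, sep, dipoleTime, tanh_div_cosh]

theorem zetaHat_two : zetaHat 2 = sep dipoleTime Real.sin Real.cos := by
  ext x
  simp [zetaHat, sep, dipoleTime, tanh_div_cosh]

theorem zetaHat_three : zetaHat 3 = sep dipoleTime Real.sin Real.sin := by
  ext x
  simp [zetaHat, sep, dipoleTime, tanh_div_cosh]

/-- The symmetric 2-tensor with vanishing `ττ` component and the given `τθ`, `τφ`, `θθ`, `θφ`,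
`φφ` components. -/
def symTensor (A B E F G : Pt → ℝ) (x : Pt) : Fin 3 → Fin 3 → ℝ :=
  ![![0, A x, B x], ![A x, E x, F x], ![B x, F x, G x]]

/-- The common form of the singular representatives `k_{(2)}` and `k_{(3)}`, whose dependence on
`φ` is through a function `p` and its derivative `q`. -/
def dipoleTensor (c : ℝ) (p q : ℝ → ℝ) : Pt → Fin 3 → Fin 3 → ℝ :=
  symTensor
    (sep (tanhSech 3) 1 p)
    (sep (tanhSech 3) (fun t => Real.cos t * Real.sin t) q)
    (sep (fun t => 2 * Real.cosh t) (divSin 3 (cubicCos c)) p)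
    (sep Real.cosh (divSin 2 (quarticCos c)) q)
    (sep (fun t => -2 * Real.cosh t) (divSin 1 (cubicCos c)) p)

theorem kk_zero (c : ℝ) : kk c 0 = symTensor 0
    (sep (fun t => 2 / Real.cosh t) (fun t => c - Real.cos t) 1) 0
    (sep Real.sinh (divSin 1 (quadraticCos c)) 1) 0 := by
  ext x a b
  fin_cases a <;> fin_cases b <;>
    simp [kk, symTensor, sep, divSin, quadraticCos, Real.cos_two_mul] <;> ring

theorem kk_one (c : ℝ) : kk c 1 = symTensor 0
    (sep (tanhSech (-3)) (fun t => Real.sin t ^ 2) 1) 0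
    (sep (fun t => -Real.cosh t) (divSin 1 (cubicCos c)) 1) 0 := by
  ext x a b
  fin_cases a <;> fin_cases b <;>
    simp [kk, symTensor, sep, tanhSech, divSin, cubicCos, Real.cos_three_mul, tanh_div_cosh] <;> ring

theorem kk_two (c : ℝ) : kk c 2 = dipoleTensor c Real.sin Real.cos := by
  ext x a b
  fin_cases a <;> fin_cases b <;>
    simp [kk, dipoleTensor, symTensor, sep, tanhSech, divSin, cubicCos, quarticCos,
      Real.cos_three_mul, tanh_div_cosh, -mul_eq_mul_right_iff] <;> ring

theorem kk_three (c : ℝ) : kk c 3 = dipoleTensor c (fun t => -Real.cos t) Real.sin := by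
  ext x a b
  fin_cases a <;> fin_cases b <;>
    simp [kk, dipoleTensor, symTensor, sep, tanhSech, divSin, cubicCos, quarticCos,
      Real.cos_three_mul, tanh_div_cosh, -mul_eq_mul_right_iff] <;> ring

theorem curlT_kk_zero (c : ℝ) {x : Pt} (hx : Real.sin (x 1) ≠ 0) (a b : Fin 3) :
    curlT (kk c 0) x a b = hess (zetaHat 0) x a b + h0 x a b * zetaHat 0 x := by
  have hc : Real.cosh (x 0) ≠ 0 := (Real.cosh_pos _).ne'
  have hS := Real.sin_sq (x 1)
  have hH := Real.cosh_sq (x 0)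
  have h1 := deriv_divSin 1 (hasDerivAt_quadraticCos c (x 1)) hx
  rw [kk_zero, zetaHat_zero]
  fin_cases a <;> fin_cases b <;>
    simp [curlT_zero _ hx, curlT_one _ hx, curlT_two, covD, hess, Fin.sum_univ_three, Chr, h0,
      symTensor, pd_zero_sep, pd_one_sep, pd_two_sep, pd_const_zero,
      deriv_monopoleTime, deriv_dipoleTime, deriv_inv_cosh,
      Real.tanh_eq_sinh_div_cosh] <;>
    simp only [sep, h1] <;>
    simp [divSin, quadraticCos, monopoleTime, dipoleTime, dipoleTimeDeriv] <;>
    field_simp <;>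
    grind

theorem curlT_kk_one (c : ℝ) {x : Pt} (hx : Real.sin (x 1) ≠ 0) (a b : Fin 3) :
    curlT (kk c 1) x a b = hess (zetaHat 1) x a b + h0 x a b * zetaHat 1 x := by
  have hc : Real.cosh (x 0) ≠ 0 := (Real.cosh_pos _).ne'
  have hS := Real.sin_sq (x 1)
  have hH := Real.cosh_sq (x 0)
  have h1 := deriv_divSin 1 (hasDerivAt_cubicCos c (x 1)) hx
  rw [kk_one, zetaHat_one]
  fin_cases a <;> fin_cases b <;>
    simp [curlT_zero _ hx, curlT_one _ hx, curlT_two, covD, hess, Fin.sum_univ_three, Chr, h0,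
      symTensor, pd_zero_sep, pd_one_sep, pd_two_sep, pd_const_zero, deriv_sin_sq,
      deriv_tanhSech, deriv_dipoleTime, deriv_dipoleTimeDeriv,
      Real.tanh_eq_sinh_div_cosh] <;>
    simp only [sep, h1] <;>
    simp [tanhSech, divSin, cubicCos, dipoleTime, dipoleTimeDeriv] <;>
    field_simp <;>
    grind

theorem curlT_dipoleTensor (c : ℝ) {p q : ℝ → ℝ} (hp : deriv p = q)
    (hq : deriv q = fun t => -p t) {x : Pt} (hx : Real.sin (x 1) ≠ 0) (a b : Fin 3) :
    curlT (dipoleTensor c p q) x a b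
      = hess (sep dipoleTime Real.sin q) x a b + h0 x a b * sep dipoleTime Real.sin q x := by
  have hc : Real.cosh (x 0) ≠ 0 := (Real.cosh_pos _).ne'
  have hS := Real.sin_sq (x 1)
  have hH := Real.cosh_sq (x 0)
  have h1 := deriv_divSin 1 (hasDerivAt_cubicCos c (x 1)) hx
  have h2 := deriv_divSin 2 (hasDerivAt_quarticCos c (x 1)) hx
  rw [dipoleTensor]
  fin_cases a <;> fin_cases b <;>
    simp [curlT_zero _ hx, curlT_one _ hx, curlT_two, covD, hess, Fin.sum_univ_three, Chr, h0,
      symTensor, pd_zero_sep, pd_one_sep, pd_two_sep, pd_const_zero, hp, hq, deriv_cos_mul_sin,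
      deriv_tanhSech, deriv_dipoleTime, deriv_dipoleTimeDeriv,
      Real.tanh_eq_sinh_div_cosh] <;>
    simp only [sep, h1, h2] <;>
    simp [tanhSech, divSin, cubicCos, quarticCos, dipoleTime, dipoleTimeDeriv] <;>
    field_simp <;>
    grind

/-- The curl of `k_{(μ)}` is symmetric and equals a nonzero constant multiple
(independent of the point and of `c`) of `D_aD_b ζ̂_μ + h⁰_{ab} ζ̂_μ`. -/
theorem stmt13 : ∀ μ : Fin 4, ∃ lam : ℝ, lam ≠ 0 ∧
    ∀ c : ℝ, ∀ x ∈ U, ∀ a b : Fin 3,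
      curlT (kk c μ) x a b = curlT (kk c μ) x b a ∧
      curlT (kk c μ) x a b
        = lam * (hess (zetaHat μ) x a b + h0 x a b * zetaHat μ x) := by
  intro μ
  refine ⟨1, one_ne_zero, fun c x hx => ?_⟩
  have hs : Real.sin (x 1) ≠ 0 := (Real.sin_pos_of_pos_of_lt_pi hx.1 hx.2).ne'
  have key : ∀ a b, curlT (kk c μ) x a b = hess (zetaHat μ) x a b + h0 x a b * zetaHat μ x := by
    match μ with
    | 0 => exact curlT_kk_zero c hs
    | 1 => exact curlT_kk_one c hs
    | 2 =>
      rw [kk_two, zetaHat_two]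
      exact curlT_dipoleTensor c Real.deriv_sin Real.deriv_cos' hs
    | 3 =>
      rw [kk_three, zetaHat_three]
      exact curlT_dipoleTensor c (by ext t; simp) (by ext t; simp) hs
  have hess_symm : ∀ a b, hess (zetaHat μ) x a b = hess (zetaHat μ) x b a := by
    obtain ⟨f, g, h, hz⟩ : ∃ f g h, zetaHat μ = sep f g h := by
      match μ with
      | 0 => exact ⟨_, _, _, zetaHat_zero⟩
      | 1 => exact ⟨_, _, _, zetaHat_one⟩
      | 2 => exact ⟨_, _, _, zetaHat_two⟩
      | 3 => exact ⟨_, _, _, zetaHat_three⟩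
    rw [hz]
    exact hess_sep_symm f g h x
  exact fun a b => ⟨by rw [key, key, hess_symm, h0_symm], by rw [key, one_mul]⟩
end
end

section
/- For each μ ∈ {0,1,2,3}, the transition function δk_{(μ)} satisfies, at every point of U: (i) it is covariantly curl-free in the antisymmetrized-derivative sense, D_a δk_{(μ)bc} = D_b δk_{(μ)ac} for all indices a,b,c; (ii) it is traceless, Σ_{a,b} h⁰^{ab} δk_{(μ)ab} = 0; (iii) it is divergence-free, Σ_{b,c} h⁰^{bc} D_c δk_{(μ)ab} = 0; and (iv) it satisfies (□ - 3)δk_{(μ)ab} = 0, i.e. Σ_{c,d} h⁰^{cd} D_dD_c δk_{(μ)ab} = 3 δk_{(μ)ab}. -/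
noncomputable section

/-- The transition functions `δk_{(μ)ab}` between the southern and northern
representatives.  Indices: `0 = τ`, `1 = θ`, `2 = φ`. -/
noncomputable def dk : Fin 4 → Pt → Fin 3 → Fin 3 → ℝ :=
  ![fun x =>
      ![![0, 0, -4 / Real.cosh (x 0)],
        ![0, 0, 4 * (Real.cos (x 1) / Real.sin (x 1)) * Real.sinh (x 0)],
        ![-4 / Real.cosh (x 0), 4 * (Real.cos (x 1) / Real.sin (x 1)) * Real.sinh (x 0), 0]],
    fun x =>
      ![![0, 0, 0],
        ![0, 0, 4 * Real.cosh (x 0) / Real.sin (x 1)],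
        ![0, 4 * Real.cosh (x 0) / Real.sin (x 1), 0]],
    fun x =>
      ![![0, 0, 0],
        ![0, -8 * Real.cosh (x 0) * Real.sin (x 2) / Real.sin (x 1) ^ 3,
          8 * Real.cos (x 1) * Real.cosh (x 0) * Real.cos (x 2) / Real.sin (x 1) ^ 2],
        ![0, 8 * Real.cos (x 1) * Real.cosh (x 0) * Real.cos (x 2) / Real.sin (x 1) ^ 2,
          8 * Real.cosh (x 0) * Real.sin (x 2) / Real.sin (x 1)]],
    fun x =>
      ![![0, 0, 0],
        ![0, 8 * Real.cosh (x 0) * Real.cos (x 2) / Real.sin (x 1) ^ 3,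
          8 * Real.cos (x 1) * Real.cosh (x 0) * Real.sin (x 2) / Real.sin (x 1) ^ 2],
        ![0, 8 * Real.cos (x 1) * Real.cosh (x 0) * Real.sin (x 2) / Real.sin (x 1) ^ 2,
          -8 * Real.cosh (x 0) * Real.cos (x 2) / Real.sin (x 1)]]]

/-- The totally symmetric 3-tensor with the given independent components. -/
def symCubic (k₀₀₀ k₀₀₁ k₀₀₂ k₀₁₁ k₀₁₂ k₀₂₂ k₁₁₁ k₁₁₂ k₁₂₂ k₂₂₂ : ℝ) :
    Fin 3 → Fin 3 → Fin 3 → ℝ :=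
  ![![![k₀₀₀, k₀₀₁, k₀₀₂], ![k₀₀₁, k₀₁₁, k₀₁₂], ![k₀₀₂, k₀₁₂, k₀₂₂]],
    ![![k₀₀₁, k₀₁₁, k₀₁₂], ![k₀₁₁, k₁₁₁, k₁₁₂], ![k₀₁₂, k₁₁₂, k₁₂₂]],
    ![![k₀₀₂, k₀₁₂, k₀₂₂], ![k₀₁₂, k₁₁₂, k₁₂₂], ![k₀₂₂, k₁₂₂, k₂₂₂]]]

/-- The covariant derivatives `D_c δk_{(μ)ab}`, in closed form. -/
def dkGrad : Fin 4 → Pt → Fin 3 → Fin 3 → Fin 3 → ℝ :=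
  ![fun x => symCubic 0 0 (8 * Real.sinh (x 0) / Real.cosh (x 0) ^ 2) 0
      (4 * (Real.cos (x 1) / Real.sin (x 1)) * (1 - Real.sinh (x 0) ^ 2) / Real.cosh (x 0)) 0 0
      (-8 * Real.sinh (x 0) * Real.cos (x 1) ^ 2 / Real.sin (x 1) ^ 2) 0 (8 * Real.sinh (x 0)),
    fun x => symCubic 0 0 0 0 (-4 * Real.sinh (x 0) / Real.sin (x 1)) 0 0
      (-8 * Real.cosh (x 0) * Real.cos (x 1) / Real.sin (x 1) ^ 2) 0
      (8 * Real.cosh (x 0) * Real.cos (x 1)),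
    fun x => symCubic 0 0 0 (8 * Real.sinh (x 0) * Real.sin (x 2) / Real.sin (x 1) ^ 3)
      (-8 * Real.cos (x 1) * Real.sinh (x 0) * Real.cos (x 2) / Real.sin (x 1) ^ 2)
      (-8 * Real.sinh (x 0) * Real.sin (x 2) / Real.sin (x 1))
      (24 * Real.cosh (x 0) * Real.cos (x 1) * Real.sin (x 2) / Real.sin (x 1) ^ 4)
      (-8 * Real.cosh (x 0) * Real.cos (x 2) * (1 + 2 * Real.cos (x 1) ^ 2) / Real.sin (x 1) ^ 3)
      (-24 * Real.cosh (x 0) * Real.cos (x 1) * Real.sin (x 2) / Real.sin (x 1) ^ 2)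
      (8 * Real.cosh (x 0) * Real.cos (x 2) * (1 + 2 * Real.cos (x 1) ^ 2) / Real.sin (x 1)),
    fun x => symCubic 0 0 0 (-8 * Real.sinh (x 0) * Real.cos (x 2) / Real.sin (x 1) ^ 3)
      (-8 * Real.cos (x 1) * Real.sinh (x 0) * Real.sin (x 2) / Real.sin (x 1) ^ 2)
      (8 * Real.sinh (x 0) * Real.cos (x 2) / Real.sin (x 1))
      (-24 * Real.cosh (x 0) * Real.cos (x 1) * Real.cos (x 2) / Real.sin (x 1) ^ 4)
      (-8 * Real.cosh (x 0) * Real.sin (x 2) * (1 + 2 * Real.cos (x 1) ^ 2) / Real.sin (x 1) ^ 3)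
      (24 * Real.cosh (x 0) * Real.cos (x 1) * Real.cos (x 2) / Real.sin (x 1) ^ 2)
      (8 * Real.cosh (x 0) * Real.sin (x 2) * (1 + 2 * Real.cos (x 1) ^ 2) / Real.sin (x 1))]

lemma symCubic_swap (k₀₀₀ k₀₀₁ k₀₀₂ k₀₁₁ k₀₁₂ k₀₂₂ k₁₁₁ k₁₁₂ k₁₂₂ k₂₂₂ : ℝ) (a b c : Fin 3) :
    symCubic k₀₀₀ k₀₀₁ k₀₀₂ k₀₁₁ k₀₁₂ k₀₂₂ k₁₁₁ k₁₁₂ k₁₂₂ k₂₂₂ a b c =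
      symCubic k₀₀₀ k₀₀₁ k₀₀₂ k₀₁₁ k₀₁₂ k₀₂₂ k₁₁₁ k₁₁₂ k₁₂₂ k₂₂₂ b a c := by
  fin_cases a <;> fin_cases b <;> fin_cases c <;> rfl

lemma dkGrad_swap (μ : Fin 4) (x : Pt) (a b c : Fin 3) :
    dkGrad μ x a b c = dkGrad μ x b a c := by
  fin_cases μ <;> exact symCubic_swap ..

lemma pd_congr {i : Fin 3} {f g : Pt → ℝ} {x : Pt} (h : f =ᶠ[nhds x] g) :
    pd i f x = pd i g x := by
  have hc : Filter.Tendsto (fun t => Function.update x i t) (nhds (x i)) (nhds x) := by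
    have : Continuous (fun t => Function.update x i t) := by fun_prop
    simpa using this.tendsto (x i)
  exact Filter.EventuallyEq.deriv_eq (hc.eventually h)

lemma pd_zero (f : Pt → ℝ) (x : Pt) : pd 0 f x = deriv (fun t => f ![t, x 1, x 2]) (x 0) := by
  unfold pd
  congr! 3 with t
  ext i; fin_cases i <;> simp

lemma pd_one (f : Pt → ℝ) (x : Pt) : pd 1 f x = deriv (fun t => f ![x 0, t, x 2]) (x 1) := by
  unfold pd
  congr! 3 with t
  ext i; fin_cases i <;> simp

lemma pd_two (f : Pt → ℝ) (x : Pt) : pd 2 f x = deriv (fun t => f ![x 0, x 1, t]) (x 2) := by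
  unfold pd
  congr! 3 with t
  ext i; fin_cases i <;> simp

set_option maxHeartbeats 1000000 in
lemma covD_dk (μ : Fin 4) {x : Pt} (hs : Real.sin (x 1) ≠ 0) (a b c : Fin 3) :
    covD (dk μ) x a b c = dkGrad μ x a b c := by
  have hC : Real.cosh (x 0) ≠ 0 := (Real.cosh_pos _).ne'
  have h1 : Real.cosh (x 0) ^ 2 = Real.sinh (x 0) ^ 2 + 1 := Real.cosh_sq _
  have h2 : Real.cos (x 1) ^ 2 = 1 - Real.sin (x 1) ^ 2 := Real.cos_sq' _
  fin_cases μ <;> fin_cases a <;> fin_cases b <;> fin_cases c <;>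
    simp only [covD, pd_zero, pd_one, pd_two, dk, dkGrad, symCubic, Chr, Fin.sum_univ_three,
      Fin.isValue, Fin.reduceFinMk, Fin.zero_eta, Fin.mk_one, Matrix.cons_val, mul_zero, zero_mul,
      add_zero, zero_add, sub_zero, zero_sub, Real.tanh_eq_sinh_div_cosh, deriv_const] <;>
    (try simp (disch := first | assumption | exact pow_ne_zero _ hs |
        fun_prop (disch := first | assumption | exact pow_ne_zero _ hs))
        [deriv_fun_div, deriv_fun_mul]) <;>
    field_simp <;> first | ring1 | (ring_nf; simp only [h1, h2]; ring1)

lemma boxT_dk (μ : Fin 4) {x : Pt} (hs : Real.sin (x 1) ≠ 0) (a b : Fin 3) :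
    boxT (dk μ) x a b = ∑ c, ∑ d, h0inv x c d * (pd d (fun y => dkGrad μ y c a b) x
      - (∑ e, Chr x e d c * dkGrad μ x e a b) - (∑ e, Chr x e d a * dkGrad μ x c e b)
      - (∑ e, Chr x e d b * dkGrad μ x c a e)) := by
  have hev : ∀ᶠ y in nhds x, Real.sin (y 1) ≠ 0 := by
    have : Continuous fun y : Pt => Real.sin (y 1) := by fun_prop
    exact this.continuousAt.eventually_ne hs
  have hpd (d c : Fin 3) : pd d (fun y => covD (dk μ) y c a b) x =
      pd d (fun y => dkGrad μ y c a b) x :=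
    pd_congr (hev.mono fun y hy => covD_dk μ hy c a b)
  simp only [boxT, covD2, hpd, covD_dk μ hs]

set_option maxHeartbeats 1000000 in
lemma boxT_dk_eq_three_mul (μ : Fin 4) {x : Pt} (hs : Real.sin (x 1) ≠ 0) (a b : Fin 3) :
    boxT (dk μ) x a b = 3 * dk μ x a b := by
  have hC : Real.cosh (x 0) ≠ 0 := (Real.cosh_pos _).ne'
  have h1 : Real.cosh (x 0) ^ 2 = Real.sinh (x 0) ^ 2 + 1 := Real.cosh_sq _
  have h2 : Real.cos (x 1) ^ 2 = 1 - Real.sin (x 1) ^ 2 := Real.cos_sq' _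
  rw [boxT_dk μ hs]
  fin_cases μ <;> fin_cases a <;> fin_cases b <;>
    simp only [h0inv, pd_zero, pd_one, pd_two, dk, dkGrad, symCubic, Chr, Fin.sum_univ_three,
      Fin.isValue, Fin.reduceFinMk, Fin.zero_eta, Fin.mk_one, Matrix.cons_val, mul_zero, zero_mul,
      add_zero, zero_add, sub_zero, zero_sub, Real.tanh_eq_sinh_div_cosh, deriv_const] <;>
    (try simp (disch := first | assumption | exact pow_ne_zero _ hs | exact pow_ne_zero _ hC |
        fun_prop (disch := first | assumption | exact pow_ne_zero _ hs | exact pow_ne_zero _ hC))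
        [deriv_fun_div, deriv_fun_mul]) <;>
    field_simp <;> first | ring1 | grind

/-- Properties of the transition functions `δk_{(μ)}` on `U`:
(i) `D_a δk_{bc} = D_b δk_{ac}`; (ii) traceless; (iii) divergence-free;
(iv) `(□ - 3)δk_{ab} = 0`. -/
theorem stmt15 : ∀ μ : Fin 4, ∀ x ∈ U,
    (∀ a b c : Fin 3, covD (dk μ) x a b c = covD (dk μ) x b a c) ∧
    (∑ a, ∑ b, h0inv x a b * dk μ x a b) = 0 ∧
    (∀ a : Fin 3, (∑ b, ∑ c, h0inv x b c * covD (dk μ) x c a b) = 0) ∧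
    (∀ a b : Fin 3, boxT (dk μ) x a b = 3 * dk μ x a b) := by
  intro μ x hx
  have hs : Real.sin (x 1) ≠ 0 := (Real.sin_pos_of_pos_of_lt_pi hx.1 hx.2).ne'
  have hC : Real.cosh (x 0) ≠ 0 := (Real.cosh_pos _).ne'
  have h2 : Real.cos (x 1) ^ 2 = 1 - Real.sin (x 1) ^ 2 := Real.cos_sq' _
  refine ⟨fun a b c => ?_, ?_, fun a => ?_, fun a b => ?_⟩
  · rw [covD_dk μ hs, covD_dk μ hs, dkGrad_swap]
  · fin_cases μ <;> simp [Fin.sum_univ_three, h0inv, dk] <;> field_simp <;> ring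
  · simp only [covD_dk μ hs]
    fin_cases μ <;> fin_cases a <;> simp [Fin.sum_univ_three, h0inv, dkGrad, symCubic] <;>
      field_simp <;> first | ring1 | (ring_nf; simp only [h2]; ring1)
  · exact boxT_dk_eq_three_mul μ hs a b
end
end

section
/- (Orthogonality relations.) For all μ, ν ∈ {0,1,2,3}, all τ ∈ ℝ, and all θ ∈ (0,π), the transition functions integrated against the gradients of the conformal Killing potentials satisfy ∫₀^{2π} Σ_{a} δk_{(μ)φa}(τ,θ,φ) · (Σ_b h⁰^{ab} ∂_b ζ_ν)(τ,θ,φ) dφ = -8π η_{μν}, where η is the diagonal matrix with entries (-1, 1, 1, 1). -/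
noncomputable section

/-- The four lowest parity-odd harmonics `ζ_μ`. -/
noncomputable def zeta : Fin 4 → Pt → ℝ :=
  ![fun x => Real.sinh (x 0),
    fun x => Real.cosh (x 0) * Real.cos (x 1),
    fun x => Real.cosh (x 0) * Real.sin (x 1) * Real.cos (x 2),
    fun x => Real.cosh (x 0) * Real.sin (x 1) * Real.sin (x 2)]

/-- The Minkowski matrix `η = diag(-1,1,1,1)`. -/
noncomputable def etaM : Fin 4 → Fin 4 → ℝ :=
  fun μ ν => if μ = ν then (if μ = 0 then -1 else 1) else 0

theorem integral_trig_quadratic (A B C D E : ℝ) :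
    (∫ φ in (0:ℝ)..(2 * Real.pi),
      (A + B * Real.cos φ + C * Real.sin φ + D * Real.cos φ ^ 2
        + E * (Real.sin φ * Real.cos φ))) = Real.pi * (2 * A + D) := by
  have hi : ∀ f : ℝ → ℝ, Continuous f →
      IntervalIntegrable f MeasureTheory.volume 0 (2 * Real.pi) :=
    fun f hf => hf.intervalIntegrable _ _
  rw [intervalIntegral.integral_add (hi _ (by fun_prop)) (hi _ (by fun_prop)),
    intervalIntegral.integral_add (hi _ (by fun_prop)) (hi _ (by fun_prop)),
    intervalIntegral.integral_add (hi _ (by fun_prop)) (hi _ (by fun_prop)),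
    intervalIntegral.integral_add (hi _ (by fun_prop)) (hi _ (by fun_prop))]
  simp only [intervalIntegral.integral_const_mul, intervalIntegral.integral_const,
    integral_cos, integral_sin, integral_cos_sq, integral_sin_mul_cos₁, Real.sin_two_pi,
    Real.cos_two_pi, Real.sin_zero, Real.cos_zero, smul_eq_mul]
  ring

/-- The partial derivatives `∂_b ζ_ν`. -/
theorem pd_zeta (ν : Fin 4) (b : Fin 3) (τ θ φ : ℝ) :
    pd b (zeta ν) ![τ, θ, φ] =
      (![![Real.cosh τ, 0, 0],
        ![Real.sinh τ * Real.cos θ, -(Real.cosh τ * Real.sin θ), 0],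
        ![Real.sinh τ * Real.sin θ * Real.cos φ, Real.cosh τ * Real.cos θ * Real.cos φ,
          -(Real.cosh τ * Real.sin θ * Real.sin φ)],
        ![Real.sinh τ * Real.sin θ * Real.sin φ, Real.cosh τ * Real.cos θ * Real.sin φ,
          Real.cosh τ * Real.sin θ * Real.cos φ]] : Fin 4 → Fin 3 → ℝ) ν b := by
  fin_cases ν <;> fin_cases b <;> simp [pd, zeta, Function.update]

/-- If the contraction of `δk_{(μ)φ·}` with the gradient of `ζ_ν` is a trigonometric polynomial
of degree at most two in `φ`, its integral can be read off the coefficients. -/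
theorem integral_dk_grad_zeta {μ ν : Fin 4} {τ θ : ℝ} (A B C D E : ℝ)
    (h : ∀ φ : ℝ, ∑ a, dk μ ![τ, θ, φ] 2 a *
        (∑ b, h0inv ![τ, θ, φ] a b * pd b (zeta ν) ![τ, θ, φ]) =
      A + B * Real.cos φ + C * Real.sin φ + D * Real.cos φ ^ 2
        + E * (Real.sin φ * Real.cos φ))
    (hη : 2 * A + D = -8 * etaM μ ν) :
    (∫ φ in (0:ℝ)..(2 * Real.pi),
      ∑ a, dk μ ![τ, θ, φ] 2 a *
        (∑ b, h0inv ![τ, θ, φ] a b * pd b (zeta ν) ![τ, θ, φ]))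
      = -8 * Real.pi * etaM μ ν := by
  simp only [h, integral_trig_quadratic, hη]
  ring

/-- Orthogonality relations:
`∫₀^{2π} Σ_a δk_{(μ)φa} (Σ_b h⁰^{ab} ∂_b ζ_ν) dφ = -8π η_{μν}`. -/
theorem stmt16 : ∀ (μ ν : Fin 4) (τ θ : ℝ), 0 < θ → θ < Real.pi →
    (∫ φ in (0:ℝ)..(2 * Real.pi),
      ∑ a, dk μ ![τ, θ, φ] 2 a *
        (∑ b, h0inv ![τ, θ, φ] a b * pd b (zeta ν) ![τ, θ, φ]))
      = -8 * Real.pi * etaM μ ν := by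
  intro μ ν τ θ hθ hθ'
  have hs : Real.sin θ ≠ 0 := (Real.sin_pos_of_pos_of_lt_pi hθ hθ').ne'
  have hc : Real.cosh τ ≠ 0 := (Real.cosh_pos τ).ne'
  have hcos : Real.cos θ ^ 2 = 1 - Real.sin θ ^ 2 := Real.cos_sq' θ
  set q := 4 * Real.sinh τ / (Real.cosh τ * Real.sin θ) with hq
  set r := Real.cos θ / Real.sin θ with hr
  set t := 8 * (Real.cos θ ^ 2 + 1) / Real.sin θ ^ 2 with ht
  let A : Fin 4 → Fin 4 → ℝ := ![![4, 0, 0, 0], ![0, -4, 0, 0],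
    ![0, 0, -8 / Real.sin θ ^ 2, 0], ![0, 0, 0, 8 * r ^ 2]]
  let B : Fin 4 → Fin 4 → ℝ := ![![0, 0, q, 0], ![0, 0, 4 * r, 0], ![0, -8 * r, 0, 0], 0]
  let C : Fin 4 → Fin 4 → ℝ := ![![0, 0, 0, q], ![0, 0, 0, 4 * r], 0, ![0, -8 * r, 0, 0]]
  let D : Fin 4 → Fin 4 → ℝ := ![0, 0, ![0, 0, t, 0], ![0, 0, 0, -t]]
  let E : Fin 4 → Fin 4 → ℝ := ![0, 0, ![0, 0, 0, t], ![0, 0, t, 0]]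
  refine integral_dk_grad_zeta (A μ ν) (B μ ν) (C μ ν) (D μ ν) (E μ ν) (fun φ => ?_) ?_
  · have hsin : Real.sin φ ^ 2 = 1 - Real.cos φ ^ 2 := Real.sin_sq φ
    fin_cases μ <;> fin_cases ν <;>
      simp [Fin.sum_univ_three, pd_zeta, dk, h0inv, A, B, C, D, E, hq, hr, ht] <;>
      field_simp <;> grind
  · fin_cases μ <;> fin_cases ν <;> simp [etaM, A, D, hr, ht] <;> field_simp <;> grind
end
end
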